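/- Fix a smooth even function χ : ℝ → [0,1] with χ = 1 on [-1,1] and support in [-2,2]. There is a constant C > 0, depending only on χ, with the following property. Let t > 0, ε > 0, M ≥ 1 with M·ε·t^{1/3} ≤ 1, and let u : ℝ → ℝ be a Schwartz function satisfying the bootstrap bounds with constants M, ε at time t, as well as ‖u‖_{B^{-1/2,ε}_{2,∞}} ≤ ε and ‖L^{NL}u(t)‖_{Ḣ^{1/2}} ≤ M·ε. Let u_lo := 𝓕^{-1}(χ(t^{1/3}ξ)·𝓕u(ξ)). Then for all x ∈ ℝ: |u_lo(x)| ≤ C·M·ε·⟨x⟩^{-1}·(1 + ln(t^{-1/3}⟨x⟩)). -/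

import Mathlib

open MeasureTheory Real SchwartzMap Set
open scoped FourierTransform

noncomputable section

/-- Fourier transform of a real-valued function on `ℝ`. -/
def FT (u : ℝ → ℝ) : ℝ → ℂ := 𝓕 (fun x => (u x : ℂ))

/-- Homogeneous Sobolev norm `‖u‖_{Ḣˢ}`. -/
def HsNorm (s : ℝ) (u : ℝ → ℝ) : ℝ :=
  (∫ ξ : ℝ, |ξ| ^ (2 * s) * ‖FT u ξ‖ ^ 2) ^ (1/2 : ℝ)

/-- Homogeneous Besov norm `‖u‖_{Ḃ^{-1/2}_{2,∞}}`. -/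
def BesovNorm (u : ℝ → ℝ) : ℝ :=
  ⨆ j : ℤ, (2:ℝ) ^ (-(j:ℝ)/2) *
    (∫ ξ in {ξ : ℝ | (2:ℝ)^j ≤ |ξ| ∧ |ξ| < (2:ℝ)^(j+1)}, ‖FT u ξ‖^2) ^ (1/2:ℝ)

/-- `L²` norm. -/
def L2Norm (u : ℝ → ℝ) : ℝ := (∫ x : ℝ, u x ^ 2) ^ (1/2:ℝ)

/-- `L²` norm restricted to a set. -/
def L2NormOn (A : Set ℝ) (u : ℝ → ℝ) : ℝ := (∫ x in A, u x ^ 2) ^ (1/2:ℝ)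

/-- The time-dependent japanese bracket `⟨x⟩ = (x² + t^{2/3})^{1/2}`. -/
def jb (t x : ℝ) : ℝ := (x^2 + t ^ ((2:ℝ)/3)) ^ (1/2:ℝ)

/-- The flattened Besov norm `‖u‖_{B^{-1/2,ε}_{2,∞}}`. -/
def BesovEpsNorm (ε : ℝ) (u : ℝ → ℝ) : ℝ :=
  sInf {c : ℝ | ∃ g h : ℝ → ℝ, u = g + h ∧ c = BesovNorm g + ε ^ (-(1:ℝ)/2) * L2Norm h}

/-- The bootstrap bounds with constants `M`, `ε` at time `t`. -/
def Bootstrap (M ε t : ℝ) (u : ℝ → ℝ) : Prop :=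
  ∀ x : ℝ, |u x| ≤ M * ε * t ^ (-(1:ℝ)/4) * jb t x ^ (-(1:ℝ)/4) ∧
    |deriv u x| ≤ M * ε * t ^ (-(3:ℝ)/4) * jb t x ^ ((1:ℝ)/4)

/-- The nonlinear operator `L^{NL}u(t)(x) = x·u(x) - 3t·u''(x) + 9t·u(x)²`. -/
def LNL (t : ℝ) (u : ℝ → ℝ) : ℝ → ℝ :=
  fun x => x * u x - 3 * t * iteratedDeriv 2 u x + 9 * t * u x ^ 2

/-- `χ` is a smooth even cutoff, valued in `[0,1]`, equal to `1` on `[-1,1]`,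
supported in `[-2,2]`. -/
def IsCutoff (χ : ℝ → ℝ) : Prop :=
  ContDiff ℝ (⊤ : ℕ∞) χ ∧ (∀ x, χ (-x) = χ x) ∧ (∀ x, 0 ≤ χ x ∧ χ x ≤ 1) ∧
    (∀ x ∈ Set.Icc (-1:ℝ) 1, χ x = 1) ∧ Function.support χ ⊆ Set.Icc (-2:ℝ) 2

/-- The low frequency part `u_lo = 𝓕⁻¹(χ(t^{1/3}ξ)𝓕u)`. -/
def uLo (χ : ℝ → ℝ) (t : ℝ) (u : ℝ → ℝ) : ℝ → ℂ :=
  𝓕⁻ (fun ξ : ℝ => ((χ (t ^ ((1:ℝ)/3) * ξ) : ℝ) : ℂ) * FT u ξ)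

/-- The affine rescaling `z ↦ f (x + s z)` of a Schwartz function. -/
def affineComp (s : ℝ) (hs : 0 < s) (x : ℝ) (f : 𝓢(ℝ, ℂ)) : 𝓢(ℝ, ℂ) :=
  compCLMOfAntilipschitz ℝ (K := (Real.toNNReal s)⁻¹) (g := fun z => x + s * z)
    (by fun_prop)
    (by
      refine AntilipschitzWith.of_le_mul_dist fun y z => ?_
      have h : dist (x + s * y) (x + s * z) = s * dist y z := by
        rw [dist_add_left, Real.dist_eq, Real.dist_eq, ← mul_sub, abs_mul, abs_of_pos hs]
      rw [h, NNReal.coe_inv, Real.coe_toNNReal _ hs.le, inv_mul_cancel_left₀ hs.ne']) f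

lemma affineComp_apply {s : ℝ} (hs : 0 < s) (x : ℝ) (f : 𝓢(ℝ, ℂ)) (z : ℝ) :
    affineComp s hs x f z = f (x + s * z) := rfl

lemma deriv_affineComp {s : ℝ} (hs : 0 < s) (x : ℝ) (f : 𝓢(ℝ, ℂ)) (z : ℝ) :
    deriv (affineComp s hs x f) z = s * deriv f (x + s * z) := by
  have h1 : HasDerivAt (fun z : ℝ => x + s * z) s z := by
    simpa using ((hasDerivAt_id z).const_mul s).const_add x
  have h2 := (f.hasDerivAt (x + s * z)).scomp z h1
  simpa using! h2.deriv

/-- The kernel `κ` at scale `s` tested against `f` around the point `x`. -/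
def kernelAvg (κ f : ℝ → ℂ) (s x : ℝ) : ℂ := ∫ z, κ z * f (x + s * z)

lemma integrable_kernelAvg (κ f : 𝓢(ℝ, ℂ)) {s : ℝ} (hs : 0 < s) (x : ℝ) :
    Integrable fun z => κ z * f (x + s * z) :=
  (pairing (ContinuousLinearMap.mul ℝ ℂ) κ (affineComp s hs x f)).integrable

lemma fourier_affineComp {s : ℝ} (hs : 0 < s) (x : ℝ) (f : 𝓢(ℝ, ℂ)) (η : ℝ) :
    𝓕 (affineComp s hs x f) (s * η) =
      (s : ℂ)⁻¹ * (Complex.exp ((2 * π * (x * η) : ℝ) * Complex.I) * 𝓕 f η) := by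
  rw [fourier_coe, fourier_coe, Real.fourier_eq', Real.fourier_eq']
  have key : ∀ z : ℝ, Complex.exp ((↑(-2 * π * inner ℝ z (s * η)) * Complex.I)) •
      affineComp s hs x f z = (fun y : ℝ => Complex.exp ((2 * π * (x * η) : ℝ) * Complex.I) *
        (Complex.exp ((↑(-2 * π * inner ℝ y η) * Complex.I)) • f y)) (x + s * z) := by
    intro z
    simp only [affineComp_apply, smul_eq_mul]
    rw [← mul_assoc, ← Complex.exp_add]
    congr 2
    simp only [RCLike.inner_apply, conj_trivial]
    push_cast
    ring
  simp_rw [key]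
  rw [Measure.integral_comp_mul_left (fun w => (fun y : ℝ =>
    Complex.exp ((2 * π * (x * η) : ℝ) * Complex.I) *
        (Complex.exp ((↑(-2 * π * inner ℝ y η) * Complex.I)) • f y)) (x + w)),
    integral_add_left_eq_self (μ := volume) (fun y : ℝ =>
    Complex.exp ((2 * π * (x * η) : ℝ) * Complex.I) *
        (Complex.exp ((↑(-2 * π * inner ℝ y η) * Complex.I)) • f y)) x,
    integral_const_mul, abs_of_pos (inv_pos.2 hs), Complex.real_smul, Complex.ofReal_inv]

lemma kernelAvg_fourier (φ f : 𝓢(ℝ, ℂ)) {s : ℝ} (hs : 0 < s) (x : ℝ) :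
    kernelAvg (𝓕 φ : 𝓢(ℝ, ℂ)) f s x =
      ∫ ξ : ℝ, Complex.exp ((2 * π * (x * ξ) : ℝ) * Complex.I) * (φ (s * ξ) * (𝓕 f : 𝓢(ℝ, ℂ)) ξ) := by
  have h1 : kernelAvg (𝓕 φ : 𝓢(ℝ, ℂ)) f s x = ∫ η, φ η * 𝓕 (affineComp s hs x f) η :=
    integral_fourier_mul_eq φ (affineComp s hs x f)
  have h2 := Measure.integral_comp_mul_left
    (fun η => φ η * 𝓕 (affineComp s hs x f) η) s
  rw [h1]
  have h3 : ∫ η, φ η * 𝓕 (affineComp s hs x f) η =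
      (s : ℂ) * ∫ ξ : ℝ, φ (s * ξ) * 𝓕 (affineComp s hs x f) (s * ξ) := by
    rw [h2, abs_of_pos (inv_pos.2 hs), Complex.real_smul, Complex.ofReal_inv,
      mul_inv_cancel_left₀ (by exact_mod_cast hs.ne')]
  rw [h3, ← integral_const_mul]
  refine integral_congr_ae (Filter.Eventually.of_forall fun ξ => ?_)
  have hs' : (s : ℂ) ≠ 0 := by exact_mod_cast hs.ne'
  simp only [fourier_affineComp]
  field_simp

lemma norm_kernelAvg_le (κ : 𝓢(ℝ, ℂ)) (f : ℝ → ℂ) {B : ℝ} (hB : ∀ y, ‖f y‖ ≤ B) (s x : ℝ) :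
    ‖kernelAvg κ f s x‖ ≤ (∫ z, ‖κ z‖) * B := by
  rw [kernelAvg, ← integral_mul_const]
  refine norm_integral_le_of_norm_le (κ.integrable.norm.mul_const B)
    (Filter.Eventually.of_forall fun z => ?_)
  rw [norm_mul]
  gcongr
  exact hB _

lemma kernelAvg_deriv (κ f : 𝓢(ℝ, ℂ)) {s : ℝ} (hs : 0 < s) (x : ℝ) :
    s * kernelAvg κ (derivCLM ℝ ℂ f) s x = -kernelAvg (derivCLM ℝ ℂ κ) f s x := by
  have h := integral_mul_deriv_eq_neg_deriv_mul κ (affineComp s hs x f)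
  simp only [deriv_affineComp, affineComp_apply] at h
  simp only [kernelAvg, derivCLM_apply]
  rw [← h, ← integral_const_mul]
  congr 1 with z
  ring

/-- Multiplication of a Schwartz function by the coordinate. -/
def mulX (f : 𝓢(ℝ, ℂ)) : 𝓢(ℝ, ℂ) := smulLeftCLM ℂ (fun x : ℝ => (x : ℂ)) f

lemma mulX_apply (f : 𝓢(ℝ, ℂ)) (x : ℝ) : mulX f x = x * f x := by
  rw [mulX, smulLeftCLM_apply_apply Function.Complex.hasTemperateGrowth_ofReal, smul_eq_mul]

lemma kernelAvg_mulX (κ f : 𝓢(ℝ, ℂ)) {s : ℝ} (hs : 0 < s) (x : ℝ) :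
    kernelAvg κ (mulX f) s x = x * kernelAvg κ f s x + s * kernelAvg (mulX κ) f s x := by
  simp only [kernelAvg]
  rw [← integral_const_mul, ← integral_const_mul, ← integral_add
    ((integrable_kernelAvg κ f hs x).const_mul _)
    ((integrable_kernelAvg (mulX κ) f hs x).const_mul _)]
  congr 1 with z
  simp only [mulX_apply]
  push_cast
  ring

/-- The operator `L^{NL}` on complex Schwartz functions. -/
def schwartzLNL (t : ℝ) (f : 𝓢(ℝ, ℂ)) : 𝓢(ℝ, ℂ) :=
  mulX f - (3 * t) • derivCLM ℝ ℂ (derivCLM ℝ ℂ f) +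
    (9 * t) • pairing (ContinuousLinearMap.mul ℝ ℂ) f f

lemma kernelAvg_add (κ f g : 𝓢(ℝ, ℂ)) {s : ℝ} (hs : 0 < s) (x : ℝ) :
    kernelAvg κ (f + g : 𝓢(ℝ, ℂ)) s x = kernelAvg κ f s x + kernelAvg κ g s x := by
  simp only [kernelAvg]
  rw [← integral_add (integrable_kernelAvg κ f hs x) (integrable_kernelAvg κ g hs x)]
  simp [mul_add]

lemma kernelAvg_smul (κ f : 𝓢(ℝ, ℂ)) (c s x : ℝ) :
    kernelAvg κ (c • f : 𝓢(ℝ, ℂ)) s x = c * kernelAvg κ f s x := by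
  simp only [kernelAvg]
  rw [← integral_const_mul]
  congr 1 with z
  simp only [smul_apply, Complex.real_smul]
  ring

lemma kernelAvg_schwartzLNL (κ f : 𝓢(ℝ, ℂ)) {s : ℝ} (hs : 0 < s) (x : ℝ) :
    kernelAvg κ (schwartzLNL (s ^ 3) f) s x = x * kernelAvg κ f s x +
      (s * kernelAvg (mulX κ) f s x - 3 * s * kernelAvg (derivCLM ℝ ℂ (derivCLM ℝ ℂ κ)) f s x
        + 9 * s ^ 3 * kernelAvg κ (pairing (ContinuousLinearMap.mul ℝ ℂ) f f) s x) := by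
  have h1 := kernelAvg_deriv κ (derivCLM ℝ ℂ f) hs x
  have h2 := kernelAvg_deriv (derivCLM ℝ ℂ κ) f hs x
  have hsub : schwartzLNL (s ^ 3) f = mulX f + (-(3 * s ^ 3)) • derivCLM ℝ ℂ (derivCLM ℝ ℂ f) +
    (9 * s ^ 3) • pairing (ContinuousLinearMap.mul ℝ ℂ) f f := by
    rw [schwartzLNL, neg_smul, sub_eq_add_neg]
  rw [hsub, kernelAvg_add _ _ _ hs, kernelAvg_add _ _ _ hs, kernelAvg_smul, kernelAvg_smul,
    kernelAvg_mulX _ _ hs]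
  push_cast
  linear_combination (-3 * s ^ 2 : ℂ) * h1 + (3 * s : ℂ) * h2

/-- The remainder bound: low frequency averages of `x u` and of `L^{NL} u` are close. -/
lemma norm_remainder_le (κ f : 𝓢(ℝ, ℂ)) {s N : ℝ} (hs : 0 < s) (hN : 0 < N) (hNs : N * s ≤ 1)
    (hf : ∀ y, ‖f y‖ ≤ N * s⁻¹) (x : ℝ) :
    ‖kernelAvg κ (schwartzLNL (s ^ 3) f) s x - x * kernelAvg κ f s x‖ ≤
      ((∫ z, ‖mulX κ z‖) + 3 * (∫ z, ‖derivCLM ℝ ℂ (derivCLM ℝ ℂ κ) z‖) + 9 * ∫ z, ‖κ z‖) * N := by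
  rw [kernelAvg_schwartzLNL κ f hs, add_sub_cancel_left]
  have h1 := norm_kernelAvg_le (mulX κ) f hf s x
  have h2 := norm_kernelAvg_le (derivCLM ℝ ℂ (derivCLM ℝ ℂ κ)) f hf s x
  have h3 := norm_kernelAvg_le κ (pairing (ContinuousLinearMap.mul ℝ ℂ) f f)
    (B := (N * s⁻¹) * (N * s⁻¹)) (fun y => by
      rw [pairing_apply_apply, ContinuousLinearMap.mul_apply', norm_mul]
      gcongr <;> exact hf y) s x
  have hκ : 0 ≤ ∫ z, ‖κ z‖ := integral_nonneg fun z => norm_nonneg _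
  set a := ∫ z, ‖mulX κ z‖
  set b := ∫ z, ‖derivCLM ℝ ℂ (derivCLM ℝ ℂ κ) z‖
  set c := ∫ z, ‖κ z‖
  refine (norm_add_le _ _).trans ((add_le_add_left (norm_sub_le _ _) _).trans ?_)
  simp only [norm_mul, norm_pow, Complex.norm_real, Real.norm_eq_abs, abs_of_pos hs,
    Complex.norm_ofNat]
  calc _ ≤ s * (a * (N * s⁻¹)) + 3 * s * (b * (N * s⁻¹)) +
        9 * s ^ 3 * (c * (N * s⁻¹ * (N * s⁻¹))) := by gcongr
    _ = a * N + 3 * b * N + 9 * c * N * (N * s) := by field_simp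
    _ ≤ a * N + 3 * b * N + 9 * c * N * 1 := by gcongr
    _ = _ := by ring

lemma integral_log_weight (a : ℝ) {b : ℝ} (hb : 0 ≤ b) :
    ∫ ξ in Icc (-b) b, a ^ 2 * |ξ| / (1 + a ^ 2 * ξ ^ 2) = Real.log (1 + a ^ 2 * b ^ 2) := by
  have hcont : Continuous fun ξ : ℝ => a ^ 2 * |ξ| / (1 + a ^ 2 * ξ ^ 2) :=
    Continuous.div (by fun_prop) (by fun_prop) fun ξ => by positivity
  have hderiv : ∀ ξ : ℝ, HasDerivAt (fun ξ : ℝ => Real.log (1 + a ^ 2 * ξ ^ 2) / 2)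
      (a ^ 2 * ξ / (1 + a ^ 2 * ξ ^ 2)) ξ := by
    intro ξ
    have h1 : HasDerivAt (fun ξ : ℝ => 1 + a ^ 2 * ξ ^ 2) (a ^ 2 * (2 * ξ)) ξ := by
      simpa using (((hasDerivAt_id ξ).pow 2).const_mul (a ^ 2)).const_add 1
    convert! (h1.log (by positivity)).div_const 2 using 1
    ring
  have hpos : ∫ ξ in (0 : ℝ)..b, a ^ 2 * |ξ| / (1 + a ^ 2 * ξ ^ 2) =
      Real.log (1 + a ^ 2 * b ^ 2) / 2 := by
    rw [intervalIntegral.integral_congr (g := fun ξ : ℝ => a ^ 2 * ξ / (1 + a ^ 2 * ξ ^ 2))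
      (fun ξ hξ => by
        rw [uIcc_of_le hb] at hξ
        simp only [abs_of_nonneg hξ.1])]
    rw [intervalIntegral.integral_eq_sub_of_hasDerivAt (fun ξ _ => hderiv ξ)
      (Continuous.intervalIntegrable
        (Continuous.div (by fun_prop) (by fun_prop) fun ξ => by positivity) _ _)]
    simp
  have hneg : ∫ ξ in (-b)..0, a ^ 2 * |ξ| / (1 + a ^ 2 * ξ ^ 2) =
      Real.log (1 + a ^ 2 * b ^ 2) / 2 := by
    rw [← hpos]
    have h := intervalIntegral.integral_comp_neg (a := 0) (b := b)
      fun ξ : ℝ => a ^ 2 * |ξ| / (1 + a ^ 2 * ξ ^ 2)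
    simp only [abs_neg, neg_sq, neg_zero] at h
    exact h.symm
  rw [integral_Icc_eq_integral_Ioc, ← intervalIntegral.integral_of_le (by linarith),
    ← intervalIntegral.integral_add_adjacent_intervals
      (hcont.intervalIntegrable (-b) 0) (hcont.intervalIntegrable 0 b), hneg, hpos]
  ring

lemma norm_exp_sub_one_sq_le {a x : ℝ} (hx : |x| ≤ a) (ξ : ℝ) :
    ‖Complex.exp ((2 * π * (x * ξ) : ℝ) * Complex.I) - 1‖ ^ 2 ≤
      (4 * π ^ 2 + 4) * (a ^ 2 * |ξ| / (1 + a ^ 2 * ξ ^ 2)) * |ξ| := by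
  set E := ‖Complex.exp ((2 * π * (x * ξ) : ℝ) * Complex.I) - 1‖ with hE
  have hE0 : 0 ≤ E := norm_nonneg _
  have h2 : E ≤ 2 := by
    refine (norm_sub_le _ _).trans ?_
    rw [Complex.norm_exp_ofReal_mul_I]
    norm_num
  have h1 : E ≤ 2 * π * (a * |ξ|) := by
    rw [hE, mul_comm _ Complex.I]
    refine Real.norm_exp_I_mul_ofReal_sub_one_le.trans ?_
    rw [Real.norm_eq_abs, abs_mul, abs_mul x, abs_of_pos (by positivity : 0 < 2 * π)]
    gcongr
  have h1' : E ^ 2 ≤ 4 * π ^ 2 * (a ^ 2 * ξ ^ 2) :=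
    (pow_le_pow_left₀ hE0 h1 2).trans_eq (by rw [mul_pow, mul_pow, mul_pow, sq_abs]; ring)
  have h2' : E ^ 2 ≤ 4 := (pow_le_pow_left₀ hE0 h2 2).trans_eq (by norm_num)
  have h3 : E ^ 2 * (1 + a ^ 2 * ξ ^ 2) ≤ (4 * π ^ 2 + 4) * (a ^ 2 * ξ ^ 2) := by
    have : E ^ 2 * (a ^ 2 * ξ ^ 2) ≤ 4 * (a ^ 2 * ξ ^ 2) := by gcongr
    linarith
  calc E ^ 2 ≤ (4 * π ^ 2 + 4) * (a ^ 2 * ξ ^ 2) / (1 + a ^ 2 * ξ ^ 2) :=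
        (le_div_iff₀ (by positivity)).2 h3
    _ = _ := by rw [← sq_abs ξ]; ring

lemma integrable_abs_mul_norm_sq (f : 𝓢(ℝ, ℂ)) : Integrable fun ξ : ℝ => |ξ| * ‖f ξ‖ ^ 2 := by
  have h := (pairing (ContinuousLinearMap.mul ℝ ℂ) (mulX f) f).integrable (μ := volume) |>.norm
  refine h.congr (Filter.Eventually.of_forall fun ξ => ?_)
  simp only [pairing_apply_apply, ContinuousLinearMap.mul_apply', mulX_apply, norm_mul,
    Complex.norm_real, Real.norm_eq_abs]
  ring

/-- Oscillation of a low frequency average, controlled by the `Ḣ^{1/2}` norm with a logarithmic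
loss. -/
lemma norm_kernelAvg_sub_le (φ f : 𝓢(ℝ, ℂ)) (hφ : ∀ η, ‖φ η‖ ≤ 1)
    (hφ' : ∀ η, 2 < |η| → φ η = 0) {s N a x : ℝ} (hs : 0 < s) (hN : 0 < N) (hx : |x| ≤ a)
    (hf : ∫ ξ : ℝ, |ξ| * ‖(𝓕 f : 𝓢(ℝ, ℂ)) ξ‖ ^ 2 ≤ N ^ 2) :
    ‖kernelAvg (𝓕 φ : 𝓢(ℝ, ℂ)) f s x - kernelAvg (𝓕 φ : 𝓢(ℝ, ℂ)) f s 0‖ ≤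
      N / 2 * ((4 * π ^ 2 + 4) * Real.log (1 + a ^ 2 * (2 / s) ^ 2) + 1) := by
  set w : ℝ → ℝ := fun ξ => a ^ 2 * |ξ| / (1 + a ^ 2 * ξ ^ 2) with hw
  set S := Icc (-(2 / s)) (2 / s)
  have hwcont : Continuous w :=
    Continuous.div (by fun_prop) (by fun_prop) fun ξ => by positivity
  have hw0 : ∀ ξ, 0 ≤ w ξ := fun ξ => by positivity
  have hwint : Integrable (S.indicator w) :=
    (integrable_indicator_iff measurableSet_Icc).2 hwcont.continuousOn.integrableOn_Icc
  have hprod : Integrable fun ξ : ℝ => φ (s * ξ) * (𝓕 f : 𝓢(ℝ, ℂ)) ξ := by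
    refine (𝓕 f : 𝓢(ℝ, ℂ)).integrable.bdd_mul (c := 1) ?_ (Filter.Eventually.of_forall fun ξ => hφ _)
    exact (φ.continuous.comp (by fun_prop)).aestronglyMeasurable
  have hexp : ∀ y : ℝ, Integrable fun ξ : ℝ => Complex.exp ((2 * π * (y * ξ) : ℝ) * Complex.I) *
      (φ (s * ξ) * (𝓕 f : 𝓢(ℝ, ℂ)) ξ) := by
    intro y
    refine hprod.bdd_mul (c := 1) ?_ (Filter.Eventually.of_forall fun ξ => ?_)
    · exact Continuous.aestronglyMeasurable (by fun_prop)
    · rw [Complex.norm_exp_ofReal_mul_I]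
  rw [kernelAvg_fourier φ f hs, kernelAvg_fourier φ f hs, ← integral_sub (hexp x) (hexp 0)]
  have hpt : ∀ ξ : ℝ, ‖Complex.exp ((2 * π * (x * ξ) : ℝ) * Complex.I) *
        (φ (s * ξ) * (𝓕 f : 𝓢(ℝ, ℂ)) ξ) - Complex.exp ((2 * π * (0 * ξ) : ℝ) * Complex.I) *
        (φ (s * ξ) * (𝓕 f : 𝓢(ℝ, ℂ)) ξ)‖ ≤
      N / 2 * (4 * π ^ 2 + 4) * S.indicator w ξ +
        (2 * N)⁻¹ * (|ξ| * ‖(𝓕 f : 𝓢(ℝ, ℂ)) ξ‖ ^ 2) := by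
    intro ξ
    have hind : 0 ≤ S.indicator w ξ := indicator_nonneg (fun ξ _ => hw0 ξ) ξ
    rw [← sub_mul, zero_mul, mul_zero, Complex.ofReal_zero, zero_mul, Complex.exp_zero,
      norm_mul, norm_mul]
    by_cases hξ : ξ ∈ S
    · rw [indicator_of_mem hξ]
      have hE := norm_exp_sub_one_sq_le hx ξ
      set E := ‖Complex.exp ((2 * π * (x * ξ) : ℝ) * Complex.I) - 1‖ with hEdef
      set g := ‖(𝓕 f : 𝓢(ℝ, ℂ)) ξ‖
      have hg : 0 ≤ g := norm_nonneg _
      have hE0 : 0 ≤ E := norm_nonneg _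
      have hle : E * (‖φ (s * ξ)‖ * g) ≤ E * g := by
        gcongr
        exact mul_le_of_le_one_left hg (hφ _)
      refine hle.trans ?_
      rcases eq_or_ne ξ 0 with rfl | h0
      · have : E = 0 := by simp [hEdef]
        rw [this, zero_mul]
        have := hw0 0
        positivity
      · have hξ0 : 0 < |ξ| := abs_pos.2 h0
        have h4 : E ^ 2 / |ξ| ≤ (4 * π ^ 2 + 4) * w ξ := (div_le_iff₀ hξ0).2 hE
        calc E * g ≤ N / 2 * (E ^ 2 / |ξ|) + (2 * N)⁻¹ * (|ξ| * g ^ 2) := by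
              have h5 : N / 2 * (E ^ 2 / |ξ|) + (2 * N)⁻¹ * (|ξ| * g ^ 2) - E * g =
                  (N * E - |ξ| * g) ^ 2 / (2 * N * |ξ|) := by
                field_simp
                ring
              have h6 : 0 ≤ (N * E - |ξ| * g) ^ 2 / (2 * N * |ξ|) := by positivity
              linarith
          _ ≤ N / 2 * ((4 * π ^ 2 + 4) * w ξ) + (2 * N)⁻¹ * (|ξ| * g ^ 2) := by gcongr
          _ = _ := by ring
    · have h2 : 2 < |s * ξ| := by
        by_contra! h
        refine hξ (abs_le.1 ?_)
        rw [abs_mul, abs_of_pos hs] at h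
        rwa [le_div_iff₀' hs]
      rw [hφ' _ h2, norm_zero, zero_mul, mul_zero]
      positivity
  refine (norm_integral_le_of_norm_le ((hwint.const_mul _).add
    ((integrable_abs_mul_norm_sq _).const_mul _)) (Filter.Eventually.of_forall hpt)).trans ?_
  simp only [Pi.add_apply]
  rw [integral_add (hwint.const_mul _) ((integrable_abs_mul_norm_sq _).const_mul _),
    integral_const_mul, integral_const_mul, integral_indicator measurableSet_Icc,
    integral_log_weight a (by positivity)]
  calc _ ≤ N / 2 * (4 * π ^ 2 + 4) * Real.log (1 + a ^ 2 * (2 / s) ^ 2) + (2 * N)⁻¹ * N ^ 2 := by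
        gcongr
    _ = _ := by field_simp

/-- The complexification of a real Schwartz function. -/
def toComplex (u : 𝓢(ℝ, ℝ)) : 𝓢(ℝ, ℂ) := postcompCLM Complex.ofRealCLM u

lemma toComplex_apply (u : 𝓢(ℝ, ℝ)) (x : ℝ) : toComplex u x = (u x : ℂ) := rfl

lemma derivCLM_toComplex (u : 𝓢(ℝ, ℝ)) :
    derivCLM ℝ ℂ (toComplex u) = toComplex (derivCLM ℝ ℝ u) := by
  ext x
  rw [derivCLM_apply, toComplex_apply, derivCLM_apply]
  exact (u.hasDerivAt x).ofReal_comp.deriv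

lemma schwartzLNL_toComplex (t : ℝ) (u : 𝓢(ℝ, ℝ)) (x : ℝ) :
    schwartzLNL t (toComplex u) x = (LNL t u x : ℂ) := by
  have h : iteratedDeriv 2 u x = derivCLM ℝ ℝ (derivCLM ℝ ℝ u) x := by
    rw [iteratedDeriv_succ, iteratedDeriv_one, derivCLM_apply]
    rfl
  simp only [schwartzLNL, derivCLM_toComplex, add_apply, sub_apply, smul_apply, mulX_apply,
    pairing_apply_apply, ContinuousLinearMap.mul_apply', toComplex_apply, Complex.real_smul,
    LNL, h]
  push_cast
  ring

lemma FT_LNL (t : ℝ) (u : 𝓢(ℝ, ℝ)) (ξ : ℝ) :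
    FT (LNL t u) ξ = (𝓕 (schwartzLNL t (toComplex u)) : 𝓢(ℝ, ℂ)) ξ := by
  have h : (fun x => (LNL t u x : ℂ)) = schwartzLNL t (toComplex u) :=
    funext fun x => (schwartzLNL_toComplex t u x).symm
  rw [FT, h, fourier_coe]

lemma integral_le_of_HsNorm_le {t N : ℝ} (u : 𝓢(ℝ, ℝ)) (h : HsNorm (1 / 2) (LNL t u) ≤ N) :
    ∫ ξ : ℝ, |ξ| * ‖(𝓕 (schwartzLNL t (toComplex u)) : 𝓢(ℝ, ℂ)) ξ‖ ^ 2 ≤ N ^ 2 := by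
  rw [HsNorm, ← Real.sqrt_eq_rpow] at h
  have h1 := Real.sqrt_le_iff.1 h |>.2
  simpa only [mul_one_div, div_self (two_ne_zero' ℝ), Real.rpow_one, FT_LNL] using h1

/-- A cutoff as a complex Schwartz function. -/
def cutoffSchwartz (χ : ℝ → ℝ) (hχ : IsCutoff χ) : 𝓢(ℝ, ℂ) :=
  toComplex (HasCompactSupport.toSchwartzMap
    (HasCompactSupport.of_support_subset_isCompact isCompact_Icc hχ.2.2.2.2) hχ.1)

lemma cutoffSchwartz_apply {χ : ℝ → ℝ} (hχ : IsCutoff χ) (η : ℝ) :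
    cutoffSchwartz χ hχ η = (χ η : ℂ) := rfl

lemma uLo_eq_kernelAvg {χ : ℝ → ℝ} (hχ : IsCutoff χ) {t : ℝ} (ht : 0 < t) (u : 𝓢(ℝ, ℝ)) (x : ℝ) :
    uLo χ t u x = kernelAvg (𝓕 (cutoffSchwartz χ hχ) : 𝓢(ℝ, ℂ)) (toComplex u)
      (t ^ ((1 : ℝ) / 3)) x := by
  rw [kernelAvg_fourier _ _ (by positivity), uLo, Real.fourierInv_eq']
  simp only [RCLike.inner_apply, conj_trivial, smul_eq_mul, cutoffSchwartz_apply]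
  rfl

lemma le_jb {t : ℝ} (ht : 0 < t) (x : ℝ) : t ^ ((1 : ℝ) / 3) ≤ jb t x := by
  have h : t ^ ((2 : ℝ) / 3) = (t ^ ((1 : ℝ) / 3)) ^ 2 := by
    rw [← Real.rpow_mul_natCast ht.le]
    norm_num
  rw [jb, ← Real.sqrt_eq_rpow, h]
  exact Real.le_sqrt_of_sq_le (by nlinarith [sq_nonneg x])

lemma abs_le_jb {t : ℝ} (ht : 0 < t) (x : ℝ) : |x| ≤ jb t x := by
  rw [jb, ← Real.sqrt_eq_rpow]
  exact Real.abs_le_sqrt (by have : 0 < t ^ ((2 : ℝ) / 3) := by positivity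
                             linarith)

lemma jb_le {t : ℝ} (ht : 0 < t) (x : ℝ) : jb t x ≤ |x| + t ^ ((1 : ℝ) / 3) := by
  have h : t ^ ((2 : ℝ) / 3) = (t ^ ((1 : ℝ) / 3)) ^ 2 := by
    rw [← Real.rpow_mul_natCast ht.le]
    norm_num
  have hs : 0 < t ^ ((1 : ℝ) / 3) := by positivity
  rw [jb, ← Real.sqrt_eq_rpow, h]
  refine Real.sqrt_le_iff.2 ⟨by positivity, ?_⟩
  nlinarith [mul_nonneg (abs_nonneg x) hs.le, sq_abs x]

lemma Bootstrap.abs_le {M ε t : ℝ} {u : ℝ → ℝ} (h : Bootstrap M ε t u) (ht : 0 < t)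
    (hN : 0 ≤ M * ε) (x : ℝ) : |u x| ≤ M * ε * (t ^ ((1 : ℝ) / 3))⁻¹ := by
  refine (h x).1.trans ?_
  have h1 : jb t x ^ (-(1 : ℝ) / 4) ≤ (t ^ ((1 : ℝ) / 3)) ^ (-(1 : ℝ) / 4) :=
    Real.rpow_le_rpow_of_nonpos (by positivity) (le_jb ht x) (by norm_num)
  have h2 : t ^ (-(1 : ℝ) / 4) * (t ^ ((1 : ℝ) / 3)) ^ (-(1 : ℝ) / 4) = (t ^ ((1 : ℝ) / 3))⁻¹ := by
    rw [← Real.rpow_mul ht.le, ← Real.rpow_add ht, ← Real.rpow_neg ht.le]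
    norm_num
  rw [← h2, ← mul_assoc]
  gcongr

lemma log_weight_le {s a : ℝ} (hs : 0 < s) (ha : s ≤ a) :
    Real.log (1 + a ^ 2 * (2 / s) ^ 2) ≤ 4 + 2 * Real.log (s⁻¹ * a) := by
  have hr : 1 ≤ s⁻¹ * a := by
    rw [inv_mul_eq_div]
    exact (one_le_div₀ hs).2 ha
  have h1 : 1 + a ^ 2 * (2 / s) ^ 2 ≤ 5 * (s⁻¹ * a) ^ 2 := by
    have h2 : a ^ 2 * (2 / s) ^ 2 = 4 * (s⁻¹ * a) ^ 2 := by
      field_simp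
      norm_num
    nlinarith
  refine (Real.log_le_log (by positivity) h1).trans ?_
  rw [Real.log_mul (by norm_num) (by positivity), Real.log_pow]
  have := Real.log_le_sub_one_of_pos (show (0 : ℝ) < 5 by norm_num)
  push_cast
  linarith

/-- Pointwise bound for the low frequency part of `u`. -/
theorem u_lo_pointwise_bound :
    ∀ χ : ℝ → ℝ, IsCutoff χ →
    ∃ C : ℝ, 0 < C ∧
      ∀ t ε M : ℝ, 0 < t → 0 < ε → 1 ≤ M → M * ε * t ^ ((1:ℝ)/3) ≤ 1 →
      ∀ u : 𝓢(ℝ, ℝ), Bootstrap M ε t ⇑u →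
        BesovEpsNorm ε ⇑u ≤ ε → HsNorm ((1:ℝ)/2) (LNL t ⇑u) ≤ M * ε →
        ∀ x : ℝ,
          ‖uLo χ t (⇑u) x‖
            ≤ C * M * ε * (jb t x)⁻¹ * (1 + Real.log (t ^ (-(1:ℝ)/3) * jb t x)) := by
  intro χ hχ
  set φ := cutoffSchwartz χ hχ with hφdef
  set κ : 𝓢(ℝ, ℂ) := 𝓕 φ
  set A := ∫ z, ‖κ z‖
  set R := (∫ z, ‖mulX κ z‖) + 3 * (∫ z, ‖derivCLM ℝ ℂ (derivCLM ℝ ℂ κ) z‖) + 9 * ∫ z, ‖κ z‖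
  have hA : 0 ≤ A := integral_nonneg fun z => norm_nonneg _
  have hR : 0 ≤ R := by positivity
  set c := 4 * π ^ 2 + 4
  have hc : 0 < c := by positivity
  refine ⟨2 * R + A + 2 * c + 1, by positivity, ?_⟩
  intro t ε M ht hε hM hMε u hboot _ hHs x
  have hN : 0 < M * ε := by positivity
  have hUbound : ∀ y, ‖toComplex u y‖ ≤ M * ε * (t ^ ((1 : ℝ) / 3))⁻¹ := fun y => by
    rw [toComplex_apply, Complex.norm_real]
    exact hboot.abs_le ht hN.le y
  have hjb := le_jb ht x
  have hxjb := abs_le_jb ht x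
  have hjble := jb_le ht x
  have hF := integral_le_of_HsNorm_le u hHs
  rw [uLo_eq_kernelAvg hχ ht]
  have hts : t = (t ^ ((1 : ℝ) / 3)) ^ 3 := by
    rw [← Real.rpow_mul_natCast ht.le]
    norm_num
  have hneg : t ^ (-(1 : ℝ) / 3) = (t ^ ((1 : ℝ) / 3))⁻¹ := by
    rw [← Real.rpow_neg ht.le]
    norm_num
  rw [hneg]
  set s := t ^ ((1 : ℝ) / 3) with hsdef
  have hs : 0 < s := by positivity
  set N := M * ε with hNdef
  set a := jb t x
  have ha : 0 < a := hs.trans_le hjb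
  have hrem := norm_remainder_le κ (toComplex u) hs hN hMε hUbound
  rw [← hts] at hrem
  have hosc := norm_kernelAvg_sub_le φ (schwartzLNL t (toComplex u)) (x := x) (a := a)
    (fun η => by
      rw [hφdef, cutoffSchwartz_apply, Complex.norm_real, Real.norm_eq_abs,
        abs_of_nonneg (hχ.2.2.1 η).1]
      exact (hχ.2.2.1 η).2)
    (fun η hη => by
      rw [hφdef, cutoffSchwartz_apply, Complex.ofReal_eq_zero]
      by_contra h
      exact hη.not_ge (abs_le.2 (hχ.2.2.2.2 h))) hs hN hxjb hF
  have hbd := norm_kernelAvg_le κ (toComplex u) hUbound s x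
  have hlog := log_weight_le hs hjb
  have hL : 0 ≤ Real.log (s⁻¹ * a) := Real.log_nonneg (by
    rw [inv_mul_eq_div]
    exact (one_le_div₀ hs).2 hjb)
  have hx := hrem x
  have h0 := hrem 0
  rw [Complex.ofReal_zero, zero_mul, sub_zero] at h0
  set L := Real.log (s⁻¹ * a)
  set v := kernelAvg κ (toComplex u) s x
  have hxv : |x| * ‖v‖ ≤ R * N + R * N + N / 2 * (c * (4 + 2 * L) + 1) := by
    set F : ℝ → ℂ := kernelAvg κ (schwartzLNL t (toComplex u)) s
    have hv : (x : ℂ) * v = -(F x - x * v) + F 0 + (F x - F 0) := by ring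
    calc |x| * ‖v‖ = ‖(x : ℂ) * v‖ := by rw [norm_mul, Complex.norm_real, Real.norm_eq_abs]
      _ ≤ ‖F x - x * v‖ + ‖F 0‖ + ‖F x - F 0‖ := by
        refine (congrArg norm hv).trans_le (norm_add₃_le.trans_eq ?_)
        rw [norm_neg]
      _ ≤ R * N + R * N + N / 2 * (c * Real.log (1 + a ^ 2 * (2 / s) ^ 2) + 1) := by gcongr
      _ ≤ _ := by gcongr
  have hsv : s * ‖v‖ ≤ A * N := by
    calc s * ‖v‖ ≤ s * (A * (N * s⁻¹)) := by gcongr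
      _ = A * N := by field_simp
  have hav : a * ‖v‖ ≤ (2 * R + A + 2 * c + 1) * N * (1 + L) := by
    have h1 : a * ‖v‖ ≤ (|x| + s) * ‖v‖ := by gcongr
    have h2 : 0 ≤ N * (2 * R + A + c + 1) * L := by positivity
    nlinarith
  have hfin : (2 * R + A + 2 * c + 1) * M * ε * a⁻¹ * (1 + L) =
      ((2 * R + A + 2 * c + 1) * N * (1 + L)) / a := by
    rw [hNdef]
    ring
  rw [hfin, le_div_iff₀' ha]
  exact hav
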